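/- arXiv:2501.14474 — 3 statements merged into one kernel-verified Lean document; each statement's English description precedes it below -/
import Mathlib

section
/- Assume n ≥ 2, m ≥ 2, r_0 = 0 and r_1 ≥ 1, and fix 0 < ε < 1/16 and 0 < δ < 1/2. There is an absolute constant c > 0 such that every function 𝒜 : Θ_all^N → C_linear with the property that for every finitely supported probability distribution D on Θ_all, P_{S∼D^N}[ E_{θ∼D}[u_p(θ, 𝒜(S))] ≥ OPT(C_linear, D) − ε ] ≥ 1 − δ, must satisfy N ≥ c·(1/ε²)·log(1/δ). -/
open scoped BigOperators

/-- An agent type in the hidden-action principal-agent model with `n` actions and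
`m` outcomes: a production function `f` (a distribution over outcomes for each action)
and a nonnegative cost vector `c` with `c 0 = 0`. -/
structure AgentType (n m : ℕ) where
  f : Fin n → Fin m → ℝ
  c : Fin n → ℝ
  f_nonneg : ∀ i j, 0 ≤ f i j
  f_sum : ∀ i, ∑ j, f i j = 1
  c_nonneg : ∀ i, 0 ≤ c i
  c_zero : ∀ i : Fin n, (i : ℕ) = 0 → c i = 0

/-- The agent's expected utility for action `i` under contract `t`. -/
def uA {n m : ℕ} (θ : AgentType n m) (t : Fin m → ℝ) (i : Fin n) : ℝ :=
  (∑ j, θ.f i j * t j) - θ.c i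

/-- The principal's expected utility when the agent takes action `i` under contract `t`,
with rewards `r`. -/
def uPa {n m : ℕ} (r : Fin m → ℝ) (θ : AgentType n m) (t : Fin m → ℝ) (i : Fin n) : ℝ :=
  ∑ j, θ.f i j * (r j - t j)

/-- The set of the agent's best-response actions to contract `t`. -/
def BestResp {n m : ℕ} (θ : AgentType n m) (t : Fin m → ℝ) : Set (Fin n) :=
  {i | ∀ i', uA θ t i' ≤ uA θ t i}

/-- The principal's utility under contract `t`: the agent best-responds, breaking ties
in favor of the principal. -/
noncomputable def uP {n m : ℕ} (r : Fin m → ℝ) (θ : AgentType n m) (t : Fin m → ℝ) : ℝ :=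
  sSup (uPa r θ t '' BestResp θ t)

/-- The class of linear contracts `α • r`, `α ∈ [0,1]`. -/
def Clinear {m : ℕ} (r : Fin m → ℝ) : Set (Fin m → ℝ) :=
  {t | ∃ α : ℝ, α ∈ Set.Icc (0:ℝ) 1 ∧ t = fun j => α * r j}

/-- The class of bounded contracts `[0,1]^m`. -/
def Cbounded (m : ℕ) : Set (Fin m → ℝ) := {t | ∀ j, t j ∈ Set.Icc (0:ℝ) 1}

/-- The class of unbounded contracts `ℝ_{≥0}^m`. -/
def Cunbounded (m : ℕ) : Set (Fin m → ℝ) := {t | ∀ j, 0 ≤ t j}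

/-- A finitely supported probability distribution. -/
structure FinDist (α : Type*) where
  p : α → ℝ
  nonneg : ∀ a, 0 ≤ p a
  finite_support : (Function.support p).Finite
  total : ∑ᶠ a, p a = 1

/-- Expectation of `g` under a finitely supported distribution `D`. -/
noncomputable def expect {α : Type*} (D : FinDist α) (g : α → ℝ) : ℝ :=
  ∑ᶠ a, D.p a * g a

/-- `OPT(C, D)`: the supremum over contracts in `C` of the principal's expected utility. -/
noncomputable def OPT {n m : ℕ} (C : Set (Fin m → ℝ)) (r : Fin m → ℝ)
    (D : FinDist (AgentType n m)) : ℝ :=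
  sSup ((fun t => expect D (fun θ => uP r θ t)) '' C)

/-- Pseudo-dimension shattering: `C` shatters some `k` types in `Θ`. -/
def Shatters {n m : ℕ} (r : Fin m → ℝ) (C : Set (Fin m → ℝ))
    (Θ : Set (AgentType n m)) (k : ℕ) : Prop :=
  ∃ θ : Fin k → AgentType n m, (∀ j, θ j ∈ Θ) ∧ ∃ τ : Fin k → ℝ,
    ∀ S : Finset (Fin k), ∃ t ∈ C,
      (∀ j, j ∈ S → τ j ≤ uP r (θ j) t) ∧ (∀ j, j ∉ S → uP r (θ j) t < τ j)

/-- `Cbar` is an `ε`-approximation of `C` (representation error at most `ε`). -/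
def IsApprox (n : ℕ) {m : ℕ} (r : Fin m → ℝ) (Cbar C : Set (Fin m → ℝ)) (ε : ℝ) : Prop :=
  ∀ D : FinDist (AgentType n m), OPT Cbar r D ≥ OPT C r D - ε

/-- Best responses breaking ties in favor of the principal. -/
def BestRespP {n m : ℕ} (r : Fin m → ℝ) (θ : AgentType n m) (t : Fin m → ℝ) : Set (Fin n) :=
  {i | i ∈ BestResp θ t ∧ ∀ i' ∈ BestResp θ t, uPa r θ t i' ≤ uPa r θ t i}

/-- Principal's expected reward under the linear contract `α • r`. -/
noncomputable def rP {n m : ℕ} (r : Fin m → ℝ) (θ : AgentType n m) (α : ℝ) : ℝ :=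
  sSup ((fun i => ∑ j, θ.f i j * r j) '' BestRespP r θ (fun j => α * r j))

/-- The set of critical values of an agent type for linear contracts. -/
def CritSet {n m : ℕ} (r : Fin m → ℝ) (θ : AgentType n m) : Set ℝ :=
  {α | α ∈ Set.Ioc (0:ℝ) 1 ∧ ∀ ε : ℝ, 0 < ε → ε ≤ α → rP r θ (α - ε) ≠ rP r θ α}

/-- Probability of the event `E` under `N` i.i.d. samples from `D`. -/
noncomputable def prodProb {α : Type*} (D : FinDist α) (N : ℕ) (E : Set (Fin N → α)) : ℝ :=
  ∑ᶠ s ∈ E, ∏ i, D.p (s i)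

/-- The class of `ε`-discrete linear contracts. -/
def Leps {m : ℕ} (r : Fin m → ℝ) (ε : ℝ) : Set (Fin m → ℝ) :=
  {t | ∃ α : ℝ, ((∃ k : ℕ, α = k * ε ∧ k * ε ≤ 1) ∨ α = 1) ∧ t = fun j => α * r j}

open Finset

section FiniteSupport

/-- A finite sum of a function vanishing off the range of an injection. -/
lemma finsum_eq_sum_of_range {ι α : Type*} [Fintype ι] {φ : ι → α}
    (hφ : Function.Injective φ) (F : α → ℝ) (hF : ∀ a, a ∉ Set.range φ → F a = 0) :
    ∑ᶠ a, F a = ∑ k, F (φ k) := by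
  classical
  rw [finsum_eq_sum_of_support_subset (s := univ.image φ)]
  · exact sum_image fun a _ b _ h => hφ h
  · intro a ha
    by_contra h
    exact ha (hF a (by simpa using h))

/-- The distribution giving weight `p k` to `T k`. -/
noncomputable def FinDist.ofWeights {ι α : Type*} [Fintype ι] (T : ι → α)
    (hT : Function.Injective T) (p : ι → ℝ) (hp : ∀ k, 0 ≤ p k) (hsum : ∑ k, p k = 1) :
    FinDist α where
  p := Function.extend T p 0
  nonneg a := by
    by_cases h : ∃ k, T k = a
    · obtain ⟨k, rfl⟩ := h
      rw [hT.extend_apply]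
      exact hp k
    · rw [Function.extend_apply' _ _ _ h]
      rfl
  finite_support := by
    refine (Set.finite_range T).subset fun a ha => ?_
    by_contra h
    exact ha (Function.extend_apply' _ _ _ h)
  total := by
    rw [finsum_eq_sum_of_range hT _ fun a h => Function.extend_apply' p (0 : α → ℝ) a h, ← hsum]
    exact sum_congr rfl fun k _ => hT.extend_apply _ _ _

variable {ι α : Type*} [Fintype ι] {T : ι → α} (hT : Function.Injective T) {p : ι → ℝ}
  (hp : ∀ k, 0 ≤ p k) (hsum : ∑ k, p k = 1)

lemma expect_ofWeights (g : α → ℝ) :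
    expect (FinDist.ofWeights T hT p hp hsum) g = ∑ k, p k * g (T k) := by
  unfold _root_.expect FinDist.ofWeights
  rw [finsum_eq_sum_of_range hT]
  · exact sum_congr rfl fun k _ => congrArg (· * g (T k)) (hT.extend_apply _ _ _)
  · intro a h
    exact mul_eq_zero_of_left (Function.extend_apply' p (0 : α → ℝ) a h) _

open Classical in
lemma prodProb_ofWeights (N : ℕ) (E : Set (Fin N → α)) :
    prodProb (FinDist.ofWeights T hT p hp hsum) N E =
      ∑ σ : Fin N → ι with T ∘ σ ∈ E, ∏ i, p (σ i) := by
  have hφ : Function.Injective fun σ : Fin N → ι => T ∘ σ := hT.comp_left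
  unfold prodProb
  simp only [finsum_mem_def]
  rw [finsum_eq_sum_of_range hφ, sum_filter]
  · refine sum_congr rfl fun σ _ => ?_
    rw [Set.indicator_apply]
    refine if_congr Iff.rfl (prod_congr rfl fun i _ => ?_) rfl
    exact hT.extend_apply _ _ _
  · intro s hs
    rw [Set.indicator_apply, ite_eq_right_iff]
    intro _
    have : ∃ i, s i ∉ Set.range T := by
      by_contra! h
      choose σ hσ using h
      exact hs ⟨σ, funext hσ⟩
    obtain ⟨i, hi⟩ := this
    exact prod_eq_zero (mem_univ i) (Function.extend_apply' _ _ _ hi)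

end FiniteSupport

section ChiSquare

variable {ι : Type*} [Fintype ι] {N : ℕ}

lemma sum_prod_eq_pow (p : ι → ℝ) : ∑ σ : Fin N → ι, ∏ i, p (σ i) = (∑ k, p k) ^ N := by
  classical
  simpa using (Fintype.sum_pow p N).symm

/-- Change of measure for product distributions, in terms of the chi-square divergence. -/
lemma sq_sum_prod_sub_le (p q : ι → ℝ) (hp : ∀ k, 0 < p k) (hps : ∑ k, p k = 1)
    (hqs : ∑ k, q k = 1) (E : Finset (Fin N → ι)) :
    (∑ σ ∈ E, ∏ i, q (σ i) - ∑ σ ∈ E, ∏ i, p (σ i)) ^ 2 ≤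
      (∑ σ ∈ E, ∏ i, p (σ i)) * ((1 + ∑ k, (q k - p k) ^ 2 / p k) ^ N - 1) := by
  set P : (Fin N → ι) → ℝ := fun σ => ∏ i, p (σ i) with hP
  set Q : (Fin N → ι) → ℝ := fun σ => ∏ i, q (σ i) with hQ
  have hPpos : ∀ σ, 0 < P σ := fun σ => prod_pos fun i _ => hp _
  have hone : 1 + ∑ k, (q k - p k) ^ 2 / p k = ∑ k, q k ^ 2 / p k := by
    have h : ∀ k, (q k - p k) ^ 2 / p k = q k ^ 2 / p k - 2 * q k + p k := fun k => by
      have := (hp k).ne'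
      field_simp
      ring
    simp only [h, sum_add_distrib, sum_sub_distrib, ← mul_sum, hps, hqs]
    ring
  have hpow : (1 + ∑ k, (q k - p k) ^ 2 / p k) ^ N - 1 = ∑ σ, (Q σ - P σ) ^ 2 / P σ := by
    have h : ∀ σ, (Q σ - P σ) ^ 2 / P σ = ∏ i, (q (σ i) ^ 2 / p (σ i)) - 2 * Q σ + P σ :=
      fun σ => by
        rw [prod_div_distrib, prod_pow]
        change _ = Q σ ^ 2 / P σ - _ + _
        have := (hPpos σ).ne'
        field_simp
        ring
    simp only [h, sum_add_distrib, sum_sub_distrib, ← mul_sum]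
    rw [sum_prod_eq_pow fun k => q k ^ 2 / p k, hone]
    simp only [hP, hQ, sum_prod_eq_pow, hps, hqs]
    simp
    ring
  rw [hpow, ← sum_sub_distrib]
  calc (∑ σ ∈ E, (Q σ - P σ)) ^ 2
      ≤ (∑ σ ∈ E, P σ) * ∑ σ ∈ E, (Q σ - P σ) ^ 2 / P σ := by
        refine sum_sq_le_sum_mul_sum_of_sq_le_mul E (fun σ _ => (hPpos σ).le)
          (fun σ _ => div_nonneg (sq_nonneg _) (hPpos σ).le) fun σ _ => ?_
        rw [mul_div_cancel₀ _ (hPpos σ).ne']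
    _ ≤ _ := by
        refine mul_le_mul_of_nonneg_left ?_ (sum_nonneg fun σ _ => (hPpos σ).le)
        exact sum_le_sum_of_subset_of_nonneg (subset_univ _)
          fun σ _ _ => div_nonneg (sq_nonneg _) (hPpos σ).le

/-- If an event has probability at most `δ / 2` under `p` and at least `1 - δ` under `q`, then
the number of samples is large relative to the chi-square divergence. -/
lemma log_inv_le_of_separated (p q : ι → ℝ) (hp : ∀ k, 0 < p k) (hps : ∑ k, p k = 1)
    (hqs : ∑ k, q k = 1) (E : Finset (Fin N → ι)) {δ C : ℝ} (hδ : 0 < δ) (hδ' : δ < 1 / 2)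
    (hC : ∑ k, (q k - p k) ^ 2 / p k ≤ C) (hPE : ∑ σ ∈ E, ∏ i, p (σ i) ≤ δ / 2)
    (hQE : 1 - δ ≤ ∑ σ ∈ E, ∏ i, q (σ i)) :
    Real.log (1 / δ) ≤ 8 * N * C := by
  have key := sq_sum_prod_sub_le p q hp hps hqs E
  set χ := ∑ k, (q k - p k) ^ 2 / p k
  have hχ : 0 ≤ χ := sum_nonneg fun k _ => div_nonneg (sq_nonneg _) (hp k).le
  set x := ∑ σ ∈ E, ∏ i, p (σ i)
  set y := ∑ σ ∈ E, ∏ i, q (σ i)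
  set X := (1 + χ) ^ N
  have hX1 : 1 ≤ X := one_le_pow₀ (by linarith)
  have hX : 1 / δ / 8 ≤ X - 1 := by
    have h1 : (1 / 4 : ℝ) ^ 2 ≤ (y - x) ^ 2 := by
      apply pow_le_pow_left₀ <;> linarith
    have h2 : x * (X - 1) ≤ δ / 2 * (X - 1) :=
      mul_le_mul_of_nonneg_right hPE (by linarith)
    rw [div_div, div_le_iff₀ (by positivity)]
    nlinarith
  have hXexp : X ≤ Real.exp (N * C) := by
    calc X ≤ Real.exp χ ^ N := by
          refine pow_le_pow_left₀ (by linarith) ?_ N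
          linarith [Real.add_one_le_exp χ]
      _ = Real.exp (N * χ) := by rw [← Real.exp_nat_mul]
      _ ≤ _ := Real.exp_le_exp.2 (by gcongr)
  rw [Real.log_le_iff_le_exp (by positivity)]
  have hδ1 : 0 < 1 / δ := by positivity
  calc 1 / δ ≤ 1 + (8 : ℕ) * (1 / δ / 8) := by push_cast; linarith
    _ ≤ (1 + 1 / δ / 8) ^ 8 := one_add_mul_le_pow (by linarith) 8
    _ ≤ X ^ 8 := pow_le_pow_left₀ (by positivity) (by linarith) 8
    _ ≤ Real.exp (N * C) ^ 8 := pow_le_pow_left₀ (by linarith) hXexp 8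
    _ = Real.exp (8 * N * C) := by
      rw [← Real.exp_nat_mul]
      congr 1
      push_cast
      ring

end ChiSquare

section ThresholdTypes

variable {n m : ℕ}

/-- The type whose action `1` has expected reward `1` and cost `a`, while all other actions
have expected reward and cost `0`. -/
noncomputable def thresholdType (n : ℕ) (hm : 2 ≤ m) (r : Fin m → ℝ)
    (hr : 1 ≤ r ⟨1, hm⟩) (a : ℝ) (ha : 0 ≤ a) : AgentType n m where
  f i := if (i : ℕ) = 1 then
      Pi.single ⟨0, by omega⟩ (1 - 1 / r ⟨1, hm⟩) +
        Pi.single ⟨1, hm⟩ (1 / r ⟨1, hm⟩)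
    else Pi.single ⟨0, by omega⟩ 1
  c i := if (i : ℕ) = 1 then a else 0
  f_nonneg i j := by
    have h1 : 1 / r ⟨1, hm⟩ ≤ 1 := by
      rw [div_le_one (by linarith)]
      exact hr
    have h0 : 0 ≤ 1 / r ⟨1, hm⟩ := by positivity
    split_ifs
    · refine add_nonneg ?_ ?_ <;> rw [Pi.single_apply] <;> split_ifs <;> linarith
    · rw [Pi.single_apply]
      split_ifs <;> norm_num
  f_sum i := by
    split_ifs <;> simp [sum_add_distrib]
  c_nonneg i := by
    split_ifs <;> simp [ha]
  c_zero i hi := by simp [hi]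

variable (hm : 2 ≤ m) (r : Fin m → ℝ) (hr : 1 ≤ r ⟨1, hm⟩)
  (h0 : ∀ j : Fin m, (j : ℕ) = 0 → r j = 0) (a : ℝ) (ha : 0 ≤ a)

include h0 in
lemma thresholdType_reward (i : Fin n) :
    ∑ j, (thresholdType n hm r hr a ha).f i j * r j = if (i : ℕ) = 1 then 1 else 0 := by
  have hr1 : r ⟨1, hm⟩ ≠ 0 := by linarith
  have hr0 : r ⟨0, by omega⟩ = 0 := h0 _ rfl
  unfold thresholdType
  split_ifs with h
  · simp [h, add_mul, sum_add_distrib, Pi.single_apply, hr0, hr1]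
  · simp [h, Pi.single_apply, hr0]

include h0 in
lemma uA_thresholdType (α : ℝ) (i : Fin n) :
    uA (thresholdType n hm r hr a ha) (fun j => α * r j) i =
      if (i : ℕ) = 1 then α - a else 0 := by
  have h : ∑ j, (thresholdType n hm r hr a ha).f i j * (α * r j) =
      α * ∑ j, (thresholdType n hm r hr a ha).f i j * r j := by
    rw [mul_sum]
    exact sum_congr rfl fun j _ => by ring
  rw [uA, h, thresholdType_reward hm r hr h0]
  unfold thresholdType
  split_ifs with h <;> simp [h]

include h0 in
lemma uPa_thresholdType (α : ℝ) (i : Fin n) :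
    uPa r (thresholdType n hm r hr a ha) (fun j => α * r j) i =
      if (i : ℕ) = 1 then 1 - α else 0 := by
  have h : uPa r (thresholdType n hm r hr a ha) (fun j => α * r j) i =
      (1 - α) * ∑ j, (thresholdType n hm r hr a ha).f i j * r j := by
    rw [uPa, mul_sum]
    exact sum_congr rfl fun j _ => by ring
  rw [h, thresholdType_reward hm r hr h0]
  split_ifs <;> simp

include h0 in
lemma uP_thresholdType (hn : 2 ≤ n) {α : ℝ} (hα1 : α ≤ 1) :
    uP r (thresholdType n hm r hr a ha) (fun j => α * r j) = if a ≤ α then 1 - α else 0 := by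
  unfold uP
  refine IsGreatest.csSup_eq ⟨?_, ?_⟩
  · split_ifs with h
    · refine ⟨⟨1, by omega⟩, fun i' => ?_, by rw [uPa_thresholdType hm r hr h0]; simp⟩
      rw [uA_thresholdType hm r hr h0, uA_thresholdType hm r hr h0]
      split_ifs <;> simp_all
    · refine ⟨⟨0, by omega⟩, fun i' => ?_, by rw [uPa_thresholdType hm r hr h0]; simp⟩
      rw [uA_thresholdType hm r hr h0, uA_thresholdType hm r hr h0]
      simp only [not_le] at h
      split_ifs <;> simp_all [h.le]
  · rintro _ ⟨i, hi, rfl⟩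
    rw [uPa_thresholdType hm r hr h0]
    split_ifs with h1 h2 h2
    · exact le_rfl
    · have := hi ⟨0, by omega⟩
      rw [uA_thresholdType hm r hr h0, uA_thresholdType hm r hr h0] at this
      simp [h1] at this
      exact absurd this h2
    · linarith
    · exact le_rfl

lemma thresholdType_injective (hn : 2 ≤ n) {κ : Type*} {a : κ → ℝ} (ha : ∀ k, 0 ≤ a k)
    (hinj : Function.Injective a) :
    Function.Injective fun k => thresholdType n hm r hr (a k) (ha k) := by
  intro k l h
  have := congrFun (congrArg AgentType.c h) ⟨1, by omega⟩
  exact hinj (by simpa [thresholdType] using this)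

end ThresholdTypes

section HardInstance

/-- The critical values of the three types of the hard instance. -/
noncomputable def critValue : Fin 3 → ℝ := ![0, 3 / 8, 1 / 2]

lemma critValue_nonneg (k : Fin 3) : 0 ≤ critValue k := by
  fin_cases k <;> norm_num [critValue]

lemma critValue_injective : Function.Injective critValue := by
  intro k l h
  fin_cases k <;> fin_cases l <;> first | rfl | (norm_num [critValue] at h)

/-- Weights for which the only near-optimal linear contracts are those whose share lies between
the `i`-th critical value and the next one, with advantage `h` over the others. -/
noncomputable def hardWeights (h : ℝ) : Fin 3 → Fin 3 → ℝ :=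
  ![![1 / 2 + h, 3 / 10 - 13 / 5 * h, 1 / 5 + 8 / 5 * h],
    ![1 / 2 - h, 3 / 10 + 13 / 5 * h, 1 / 5 - 8 / 5 * h],
    ![1 / 2 - h, 3 / 10 - 3 / 5 * h, 1 / 5 + 8 / 5 * h]]

/-- The index of the last critical value that is at most `α`. -/
noncomputable def critIndex (α : ℝ) : Fin 3 := if α < 3 / 8 then 0 else if α < 1 / 2 then 1 else 2

/-- The principal's expected utility from paying out the share `α`. -/
noncomputable def shareUtility (p : Fin 3 → ℝ) (α : ℝ) : ℝ :=
  ∑ k, p k * if critValue k ≤ α then 1 - α else 0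

lemma hardWeights_pos {h : ℝ} (h0 : 0 < h) (h1 : h < 3 / 32) (i k : Fin 3) :
    0 < hardWeights h i k := by
  fin_cases i <;> fin_cases k <;> simp [hardWeights] <;> linarith

lemma hardWeights_sum (h : ℝ) (i : Fin 3) : ∑ k, hardWeights h i k = 1 := by
  fin_cases i <;> simp [hardWeights, Fin.sum_univ_three] <;> ring

lemma shareUtility_eq (p : Fin 3 → ℝ) {α : ℝ} (hα : 0 ≤ α) :
    shareUtility p α = (p 0 + (if 3 / 8 ≤ α then p 1 else 0) + if 1 / 2 ≤ α then p 2 else 0) *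
      (1 - α) := by
  simp only [shareUtility, critValue, Fin.sum_univ_three, Matrix.cons_val, hα, if_true]
  by_cases h1 : 3 / 8 ≤ α <;> by_cases h2 : 1 / 2 ≤ α <;>
    simp only [h1, h2, if_true, if_false] <;> ring

lemma shareUtility_hardWeights_add_le {h α : ℝ} (h0 : 0 < h) (h1 : h < 3 / 32) (hα : 0 ≤ α)
    (i : Fin 3) (hi : critIndex α ≠ i) :
    shareUtility (hardWeights h i) α + h ≤ shareUtility (hardWeights h i) (critValue i) := by
  rw [shareUtility_eq _ hα, shareUtility_eq _ (critValue_nonneg i)]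
  unfold critIndex at hi
  split_ifs at hi with h2 h3
  · have h4 : ¬ 3 / 8 ≤ α := by linarith
    have h5 : ¬ 1 / 2 ≤ α := by linarith
    simp only [h4, h5, if_false]
    fin_cases i <;> first
      | exact absurd rfl hi
      | (simp only [hardWeights, critValue, Fin.isValue, Fin.mk_one, Fin.reduceFinMk,
          Matrix.cons_val]
         norm_num
         nlinarith)
  · have h4 : 3 / 8 ≤ α := by linarith
    have h5 : ¬ 1 / 2 ≤ α := by linarith
    simp only [h4, h5, if_true, if_false]
    fin_cases i <;> first
      | exact absurd rfl hi
      | (simp only [hardWeights, critValue, Fin.isValue, Fin.zero_eta, Fin.reduceFinMk,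
          Matrix.cons_val]
         norm_num
         nlinarith)
  · have h4 : 3 / 8 ≤ α := by linarith
    have h5 : 1 / 2 ≤ α := by linarith
    simp only [h4, h5, if_true]
    fin_cases i <;> first
      | exact absurd rfl hi
      | (simp only [hardWeights, critValue, Fin.isValue, Fin.mk_one, Fin.zero_eta,
          Matrix.cons_val]
         norm_num
         nlinarith)

lemma chiSq_hardWeights_le {h : ℝ} (h0 : 0 < h) (h1 : h < 3 / 32) (i : Fin 3) :
    ∑ k, (hardWeights h i k - hardWeights h 2 k) ^ 2 / hardWeights h 2 k ≤ 100 * h ^ 2 := by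
  have bound : ∀ {d b x : ℝ}, 0 < b → b ≤ x → d ^ 2 / x ≤ d ^ 2 / b := fun hb hx =>
    div_le_div_of_nonneg_left (sq_nonneg _) hb hx
  have b0 := fun d : ℝ => bound (d := d) (b := 2 / 5) (x := 1 / 2 - h) (by norm_num) (by linarith)
  have b1 := fun d : ℝ =>
    bound (d := d) (b := 6 / 25) (x := 3 / 10 - 3 / 5 * h) (by norm_num) (by linarith)
  have b2 := fun d : ℝ =>
    bound (d := d) (b := 1 / 5) (x := 1 / 5 + 8 / 5 * h) (by norm_num) (by linarith)
  rw [Fin.sum_univ_three]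
  refine (add_le_add (add_le_add (b0 _) (b1 _)) (b2 _)).trans ?_
  fin_cases i <;> simp [hardWeights] <;> nlinarith [sq_nonneg h]

end HardInstance


/-- Sample complexity lower bound for linear contracts. With `n ≥ 2`,
`m ≥ 2`, `r 0 = 0` and `r 1 ≥ 1`, there is an absolute constant `c > 0` such that any
learning rule returning linear contracts which is `(ε, δ)`-PAC for every finitely
supported type distribution must use `N ≥ c·(1/ε²)·log(1/δ)` samples. -/
theorem stmt_14 : ∃ c : ℝ, 0 < c ∧
    ∀ (n m : ℕ), 2 ≤ n → ∀ hm : 2 ≤ m, ∀ r : Fin m → ℝ,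
      (∀ j, 0 ≤ r j) → (∀ j : Fin m, (j : ℕ) = 0 → r j = 0) →
      1 ≤ r ⟨1, by omega⟩ →
      ∀ ε δ : ℝ, 0 < ε → ε < 1/16 → 0 < δ → δ < 1/2 →
      ∀ N : ℕ, ∀ 𝒜 : (Fin N → AgentType n m) → (Fin m → ℝ),
        (∀ s, 𝒜 s ∈ Clinear r) →
        (∀ D : FinDist (AgentType n m),
          prodProb D N
            {s | expect D (fun θ => uP r θ (𝒜 s)) ≥ OPT (Clinear r) r D - ε} ≥ 1 - δ) →
        (N : ℝ) ≥ c * (1/ε^2) * Real.log (1/δ) := by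
  refine ⟨1 / 1800, by norm_num, ?_⟩
  intro n m hn hm r _ h0 hr ε δ hε hε' hδ hδ' N 𝒜 hA hPAC
  classical
  have hh0 : 0 < 3 / 2 * ε := by linarith
  have hh1 : 3 / 2 * ε < 3 / 32 := by linarith
  set h := 3 / 2 * ε with hh
  choose α hα hαr using hA
  set T : Fin 3 → AgentType n m :=
    fun k => thresholdType n hm r hr (critValue k) (critValue_nonneg k)
  have hT : Function.Injective T :=
    thresholdType_injective hm r hr hn critValue_nonneg critValue_injective
  let D : Fin 3 → FinDist (AgentType n m) := fun i =>
    .ofWeights T hT (hardWeights h i) (fun k => (hardWeights_pos hh0 hh1 i k).le)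
      (hardWeights_sum h i)
  have hD : ∀ i, ∀ β ≤ (1 : ℝ), expect (D i) (fun θ => uP r θ fun j => β * r j) =
      shareUtility (hardWeights h i) β := fun i β hβ => by
    rw [expect_ofWeights]
    exact sum_congr rfl fun k _ => by
      rw [uP_thresholdType hm r hr h0 _ (critValue_nonneg k) hn hβ]
  have hcrit : ∀ i, critValue i ≤ 1 := fun i => by fin_cases i <;> norm_num [critValue]
  have hOPT : ∀ i, shareUtility (hardWeights h i) (critValue i) ≤ OPT (Clinear r) r (D i) := by
    intro i
    refine le_csSup ⟨1, ?_⟩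
      ⟨_, ⟨critValue i, ⟨critValue_nonneg i, hcrit i⟩, rfl⟩, hD i _ (hcrit i)⟩
    rintro _ ⟨_, ⟨β, hβ, rfl⟩, rfl⟩
    beta_reduce
    rw [hD i β hβ.2, ← hardWeights_sum h i]
    refine sum_le_sum fun k _ => mul_le_of_le_one_right (hardWeights_pos hh0 hh1 i k).le ?_
    split_ifs <;> linarith [hβ.1]
  let E : Fin 3 → Finset (Fin N → Fin 3) := fun i => univ.filter fun σ => critIndex (α (T ∘ σ)) = i
  have hE : ∀ i, 1 - δ ≤ ∑ σ ∈ E i, ∏ l, hardWeights h i (σ l) := by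
    intro i
    refine (hPAC (D i)).le.trans ?_
    rw [prodProb_ofWeights]
    refine sum_le_sum_of_subset_of_nonneg ?_
      fun σ _ _ => prod_nonneg fun l _ => (hardWeights_pos hh0 hh1 i _).le
    intro σ hσ
    simp only [mem_filter, mem_univ, true_and, Set.mem_ofPred_eq, E] at hσ ⊢
    by_contra hne
    have h1 := shareUtility_hardWeights_add_le hh0 hh1 (hα (T ∘ σ)).1 i hne
    rw [hαr, hD i _ (hα _).2] at hσ
    linarith [hOPT i]
  have htotal : ∑ i, ∑ σ ∈ E i, ∏ l, hardWeights h 2 (σ l) = 1 := by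
    rw [sum_fiberwise, sum_prod_eq_pow, hardWeights_sum, one_pow]
  rw [Fin.sum_univ_three] at htotal
  have hsmall : ∃ i, ∑ σ ∈ E i, ∏ l, hardWeights h 2 (σ l) ≤ δ / 2 := by
    by_contra! hc
    linarith [hc 0, hc 1, hE 2]
  obtain ⟨i, hi⟩ := hsmall
  have hlog := log_inv_le_of_separated _ _ (hardWeights_pos hh0 hh1 2) (hardWeights_sum h 2)
    (hardWeights_sum h i) (E i) hδ hδ' (chiSq_hardWeights_le hh0 hh1 i) hi (hE i)
  rw [ge_iff_le, mul_assoc, one_div_mul_eq_div, one_div_mul_eq_div, div_div,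
    div_le_iff₀ (by positivity)]
  calc Real.log (1 / δ) ≤ 8 * N * (100 * h ^ 2) := hlog
    _ = N * (ε ^ 2 * 1800) := by rw [hh]; ring
end

section
/- Assume n ≥ 2, m ≥ 2, r_0 = 0 and r_j ≥ 1 for all j ∈ {1,…,m−1}, and fix 0 < ε < 1/64 and 0 < δ ≤ 1/4. There is an absolute constant c > 0 such that every function 𝒜 : Θ_all^N → C_bounded with the property that for every finitely supported probability distribution D on Θ_all, P_{S∼D^N}[ E_{θ∼D}[u_p(θ, 𝒜(S))] ≥ OPT(C_bounded, D) − ε ] ≥ 1 − δ, must satisfy N ≥ c·(1/ε²)·(m + log(1/δ)). -/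
open scoped BigOperators

open Classical in
theorem finite_support_fiber {X α : Type*} [Fintype X] (φ : X → α) (w : X → ℝ) :
    (Function.support fun a => ∑ x, if φ x = a then w x else 0).Finite := by
  refine (Set.finite_range φ).subset fun a ha => ?_
  by_contra h
  refine ha (Finset.sum_eq_zero fun x _ => if_neg fun hx => h ⟨x, hx⟩)

open Classical in
theorem finsum_fiber_mul {X α : Type*} [Fintype X] (φ : X → α) (w : X → ℝ) (g : α → ℝ) :
    ∑ᶠ a, (∑ x, if φ x = a then w x else 0) * g a = ∑ x, w x * g (φ x) := by
  simp_rw [Finset.sum_mul]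
  rw [finsum_sum_comm]
  · refine Finset.sum_congr rfl fun x _ => ?_
    rw [finsum_eq_single _ (φ x)]
    · simp
    · intro a ha
      simp [ha.symm]
  · intro x _
    refine (Set.finite_singleton (φ x)).subset fun a ha => ?_
    by_contra h
    exact ha (by simp [show φ x ≠ a from fun hx => h hx.symm])

open Classical in
/-- The pushforward of a finite weight `w` of total mass one along `φ`. -/
noncomputable def FinDist.pushforward {X α : Type*} [Fintype X] (w : X → ℝ) (hw : ∀ x, 0 ≤ w x)
    (hsum : ∑ x, w x = 1) (φ : X → α) : FinDist α where
  p a := ∑ x, if φ x = a then w x else 0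
  nonneg a := Finset.sum_nonneg fun x _ => by split_ifs <;> simp [hw]
  finite_support := finite_support_fiber φ w
  total := by simpa [hsum] using finsum_fiber_mul φ w 1

theorem expect_pushforward {X α : Type*} [Fintype X] (w : X → ℝ) (hw : ∀ x, 0 ≤ w x)
    (hsum : ∑ x, w x = 1) (φ : X → α) (g : α → ℝ) :
    expect (FinDist.pushforward w hw hsum φ) g = ∑ x, w x * g (φ x) :=
  finsum_fiber_mul φ w g

open Classical in
theorem prodProb_pushforward {X α : Type*} [Fintype X] (w : X → ℝ) (hw : ∀ x, 0 ≤ w x)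
    (hsum : ∑ x, w x = 1) (φ : X → α) (N : ℕ) (E : Set (Fin N → α)) :
    prodProb (FinDist.pushforward w hw hsum φ) N E =
      ∑ y : Fin N → X, (∏ i, w (y i)) * if φ ∘ y ∈ E then 1 else 0 := by
  have h := finsum_fiber_mul (fun y : Fin N → X => φ ∘ y) (fun y => ∏ i, w (y i))
    (fun s => if s ∈ E then 1 else 0)
  rw [← h, prodProb, finsum_mem_def]
  refine finsum_congr fun s => ?_
  have hs : ∏ i, (FinDist.pushforward w hw hsum φ).p (s i) =
      ∑ y : Fin N → X, if φ ∘ y = s then ∏ i, w (y i) else 0 := by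
    simp only [FinDist.pushforward]
    rw [Finset.prod_univ_sum, Fintype.piFinset_univ]
    refine Finset.sum_congr rfl fun y _ => ?_
    rw [Finset.prod_ite_zero]
    simp [funext_iff]
  by_cases hE : s ∈ E
  · rw [Set.indicator_of_mem hE, hs, if_pos hE, mul_one]
    congr!
  · simp [hE]

/-! ### Affinity of product weights -/

theorem sum_prod_apply {X : Type*} [Fintype X] (p : X → ℝ) (N : ℕ) :
    ∑ y : Fin N → X, ∏ i, p (y i) = (∑ x, p x) ^ N := by
  have h := Finset.prod_univ_sum (fun _ : Fin N => (Finset.univ : Finset X)) (fun _ x => p x)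
  rw [Fintype.piFinset_univ] at h
  rw [← h]
  simp

theorem sq_sum_sqrt_mul_le {Y : Type*} [Fintype Y] (p q : Y → ℝ) (hp : ∀ y, 0 ≤ p y)
    (hq : ∀ y, 0 ≤ q y) (hps : ∑ y, p y = 1) (hqs : ∑ y, q y = 1) :
    (∑ y, √(p y * q y)) ^ 2 ≤ (∑ y, min (p y) (q y)) * (2 - ∑ y, min (p y) (q y)) := by
  have hmax : 2 - ∑ y, min (p y) (q y) = ∑ y, max (p y) (q y) := by
    have : ∑ y, (min (p y) (q y) + max (p y) (q y)) = ∑ y, (p y + q y) :=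
      Finset.sum_congr rfl fun y _ => min_add_max _ _
    rw [Finset.sum_add_distrib, Finset.sum_add_distrib, hps, hqs] at this
    linarith
  rw [hmax]
  have h := Finset.sum_mul_sq_le_sq_mul_sq Finset.univ (fun y => √(min (p y) (q y)))
    (fun y => √(max (p y) (q y)))
  have e1 : ∀ y, √(min (p y) (q y)) ^ 2 = min (p y) (q y) := fun y =>
    Real.sq_sqrt (le_min (hp y) (hq y))
  have e2 : ∀ y, √(max (p y) (q y)) ^ 2 = max (p y) (q y) := fun y =>
    Real.sq_sqrt (le_max_of_le_left (hp y))
  have e3 : ∀ y, √(min (p y) (q y)) * √(max (p y) (q y)) = √(p y * q y) := fun y => by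
    rw [← Real.sqrt_mul (le_min (hp y) (hq y)), min_mul_max]
  simpa only [e1, e2, e3] using h

theorem affinity_pow_le {X : Type*} [Fintype X] (p q : X → ℝ) (hp : ∀ x, 0 ≤ p x)
    (hq : ∀ x, 0 ≤ q x) (hps : ∑ x, p x = 1) (hqs : ∑ x, q x = 1) (N : ℕ) :
    ((∑ x, √(p x * q x)) ^ N) ^ 2 ≤
      (∑ y : Fin N → X, min (∏ i, p (y i)) (∏ i, q (y i))) *
        (2 - ∑ y : Fin N → X, min (∏ i, p (y i)) (∏ i, q (y i))) := by
  have h := sq_sum_sqrt_mul_le (fun y : Fin N → X => ∏ i, p (y i)) (fun y => ∏ i, q (y i))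
    (fun y => Finset.prod_nonneg fun i _ => hp _) (fun y => Finset.prod_nonneg fun i _ => hq _)
    (by rw [sum_prod_apply, hps, one_pow]) (by rw [sum_prod_apply, hqs, one_pow])
  have e : ∀ y : Fin N → X,
      √((∏ i, p (y i)) * ∏ i, q (y i)) = ∏ i, √(p (y i) * q (y i)) := fun y => by
    rw [← Finset.prod_mul_distrib, Real.sqrt_prod]
    exact fun i _ => mul_nonneg (hp _) (hq _)
  simp only [e] at h
  rwa [sum_prod_apply (fun x => √(p x * q x))] at h

/-! ### The hypercube family of distributions -/

/-- A uniform coordinate `j` together with a coin that agrees with `σ j` with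
probability `1/2 + γ`. -/
noncomputable def coinWeight (k : ℕ) (γ : ℝ) (σ : Fin k → Bool) (x : Fin k × Bool) : ℝ :=
  (1 / k) * (1 / 2 + if x.2 = σ x.1 then γ else -γ)

theorem coinWeight_nonneg {k : ℕ} {γ : ℝ} (h0 : 0 ≤ γ) (h1 : γ ≤ 1 / 2) (σ : Fin k → Bool)
    (x : Fin k × Bool) : 0 ≤ coinWeight k γ σ x := by
  unfold coinWeight
  refine mul_nonneg (by positivity) ?_
  split_ifs <;> linarith

theorem sum_coinWeight {k : ℕ} (hk : 0 < k) (γ : ℝ) (σ : Fin k → Bool) :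
    ∑ x, coinWeight k γ σ x = 1 := by
  have hk' : (k : ℝ) ≠ 0 := by positivity
  have h : ∀ j, ∑ b, coinWeight k γ σ (j, b) = 1 / k := fun j => by
    rw [Fintype.sum_bool]
    unfold coinWeight
    cases σ j <;> simp <;> ring
  rw [Fintype.sum_prod_type, Finset.sum_congr rfl fun j _ => h j]
  simp [hk']

theorem affinity_coinWeight {k : ℕ} (hk : 0 < k) {γ : ℝ} (h0 : 0 ≤ γ) (h1 : γ ≤ 1 / 2)
    (σ τ : Fin k → Bool) :
    1 - 4 * γ ^ 2 * (∑ j, if σ j = τ j then (0 : ℝ) else 1) / k ≤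
      ∑ x, √(coinWeight k γ σ x * coinWeight k γ τ x) := by
  have hk' : (0 : ℝ) < k := by positivity
  have hj : ∀ j, 1 / k - 4 * γ ^ 2 / k * (if σ j = τ j then (0 : ℝ) else 1) ≤
      ∑ b, √(coinWeight k γ σ (j, b) * coinWeight k γ τ (j, b)) := fun j => by
    have hsame : ∀ u : ℝ, 0 ≤ u → √((1 / k * u) * (1 / k * u)) = 1 / k * u := fun u hu =>
      Real.sqrt_mul_self (by positivity)
    have hne : ∀ u v : ℝ, u * v = 1 / 4 - γ ^ 2 →
        1 / k * (1 / 2 - 2 * γ ^ 2) ≤ √((1 / k * u) * (1 / k * v)) := fun u v huv => by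
      apply Real.le_sqrt_of_sq_le
      have : (1 / k * u) * (1 / k * v) = (1 / k : ℝ) ^ 2 * (1 / 4 - γ ^ 2) := by
        rw [← huv]; ring
      rw [this, mul_pow]
      refine mul_le_mul_of_nonneg_left ?_ (by positivity)
      nlinarith [mul_nonneg (sq_nonneg γ) (by nlinarith : (0 : ℝ) ≤ 1 / 4 - γ ^ 2)]
    have a1 := hsame (1 / 2 + γ) (by linarith)
    have a2 := hsame (1 / 2 + -γ) (by linarith)
    have b1 := hne (1 / 2 + γ) (1 / 2 + -γ) (by ring)
    have b2 := hne (1 / 2 + -γ) (1 / 2 + γ) (by ring)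
    rw [Fintype.sum_bool]
    unfold coinWeight
    have e1 : 1 / (k : ℝ) * (1 / 2 - 2 * γ ^ 2) + 1 / (k : ℝ) * (1 / 2 - 2 * γ ^ 2) =
      1 / k - 4 * γ ^ 2 / k * 1 := by ring
    have e2 : 1 / (k : ℝ) * (1 / 2 + γ) + 1 / (k : ℝ) * (1 / 2 + -γ) = 1 / k := by ring
    cases σ j <;> cases τ j <;> simp only [reduceCtorEq, if_true, if_false] <;> linarith
  rw [Fintype.sum_prod_type]
  refine le_trans (le_of_eq ?_) (Finset.sum_le_sum fun j _ => hj j)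
  rw [Finset.sum_sub_distrib, ← Finset.mul_sum]
  simp [hk'.ne']
  ring

theorem exp_le_one_sub {x : ℝ} (h0 : 0 ≤ x) (h1 : x ≤ 1 / 2) :
    Real.exp (-(2 * x)) ≤ 1 - x := by
  rw [Real.exp_neg, inv_le_comm₀ (Real.exp_pos _) (by linarith)]
  refine le_trans ?_ (Real.add_one_le_exp _)
  rw [inv_le_iff_one_le_mul₀ (by linarith)]
  nlinarith

/-- The number of coordinates on which a guess differs from `σ`. -/
def hammingErr {k : ℕ} (a σ : Fin k → Bool) : ℝ := ∑ j, if a j = σ j then 0 else 1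

section LowerBounds

variable {k N : ℕ} {γ δ : ℝ} {A : (Fin N → Fin k × Bool) → Fin k → Bool}

open Classical in
theorem mass_bad_le (hk : 0 < k) (σ : Fin k → Bool)
    (hA : 1 - δ ≤ ∑ y : Fin N → Fin k × Bool, (∏ i, coinWeight k γ σ (y i)) *
      if hammingErr (A y) σ ≤ k / 8 then 1 else 0) :
    ∑ y : Fin N → Fin k × Bool, (∏ i, coinWeight k γ σ (y i)) *
      (if hammingErr (A y) σ ≤ k / 8 then 0 else 1) ≤ δ := by
  have hs : ∑ y : Fin N → Fin k × Bool, ∏ i, coinWeight k γ σ (y i) = 1 := by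
    rw [sum_prod_apply, sum_coinWeight hk, one_pow]
  have : ∑ y : Fin N → Fin k × Bool, (∏ i, coinWeight k γ σ (y i)) *
      (if hammingErr (A y) σ ≤ k / 8 then (0 : ℝ) else 1) =
      ∑ y : Fin N → Fin k × Bool, ∏ i, coinWeight k γ σ (y i) -
      ∑ y : Fin N → Fin k × Bool, (∏ i, coinWeight k γ σ (y i)) *
        (if hammingErr (A y) σ ≤ k / 8 then (1 : ℝ) else 0) := by
    rw [← Finset.sum_sub_distrib]
    refine Finset.sum_congr rfl fun y _ => ?_
    split_ifs <;> simp
  linarith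

open Classical in
theorem log_le_of_learns (hk : 0 < k) (h0 : 0 ≤ γ) (h1 : γ ≤ 1 / 8) (hδ : 0 < δ)
    (hA : ∀ σ, 1 - δ ≤ ∑ y : Fin N → Fin k × Bool, (∏ i, coinWeight k γ σ (y i)) *
      if hammingErr (A y) σ ≤ k / 8 then 1 else 0) :
    Real.log (1 / (4 * δ)) ≤ 16 * γ ^ 2 * N := by
  have hk' : (0 : ℝ) < k := by positivity
  have hnn : ∀ σ (y : Fin N → Fin k × Bool), 0 ≤ ∏ i, coinWeight k γ σ (y i) := fun σ y =>
    Finset.prod_nonneg fun i _ => coinWeight_nonneg h0 (by linarith) _ _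
  set σ : Fin k → Bool := fun _ => true
  set τ : Fin k → Bool := fun _ => false
  set M := ∑ y : Fin N → Fin k × Bool,
    min (∏ i, coinWeight k γ σ (y i)) (∏ i, coinWeight k γ τ (y i)) with hM
  have hM0 : 0 ≤ M := Finset.sum_nonneg fun y _ => le_min (hnn σ y) (hnn τ y)
  have hMδ : M ≤ 2 * δ := by
    have e1 := mass_bad_le hk σ (hA σ)
    have e2 := mass_bad_le hk τ (hA τ)
    have : M ≤ ∑ y : Fin N → Fin k × Bool, ((∏ i, coinWeight k γ σ (y i)) *
        (if hammingErr (A y) σ ≤ k / 8 then (0 : ℝ) else 1) +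
        (∏ i, coinWeight k γ τ (y i)) *
        (if hammingErr (A y) τ ≤ k / 8 then (0 : ℝ) else 1)) := by
      refine Finset.sum_le_sum fun y _ => ?_
      have hsum : hammingErr (A y) σ + hammingErr (A y) τ = k := by
        unfold hammingErr
        rw [← Finset.sum_add_distrib]
        have : ∀ j, ((if A y j = σ j then (0 : ℝ) else 1) + if A y j = τ j then 0 else 1) = 1 :=
          fun j => by cases A y j <;> simp [σ, τ]
        simp [this]
      have m1 := min_le_left (∏ i, coinWeight k γ σ (y i)) (∏ i, coinWeight k γ τ (y i))
      have m2 := min_le_right (∏ i, coinWeight k γ σ (y i)) (∏ i, coinWeight k γ τ (y i))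
      have := hnn σ y
      have := hnn τ y
      split_ifs <;> linarith
    rw [Finset.sum_add_distrib] at this
    linarith
  have haff := affinity_coinWeight hk h0 (by linarith) σ τ
  have hham : (∑ j : Fin k, if σ j = τ j then (0 : ℝ) else 1) = k := by simp [σ, τ]
  rw [hham, mul_div_assoc, div_self hk'.ne', mul_one] at haff
  have hpow := affinity_pow_le _ _ (coinWeight_nonneg h0 (by linarith) σ)
    (coinWeight_nonneg h0 (by linarith) τ) (sum_coinWeight hk γ σ) (sum_coinWeight hk γ τ) N
  rw [← hM] at hpow
  have hexp : Real.exp (-(16 * γ ^ 2 * N)) ≤ 4 * δ := by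
    have e := exp_le_one_sub (x := 4 * γ ^ 2) (by positivity) (by nlinarith)
    have e' := pow_le_pow_left₀ (Real.exp_pos _).le (e.trans haff) N
    have e'' := pow_le_pow_left₀ (by positivity) e' 2
    have : (Real.exp (-(2 * (4 * γ ^ 2))) ^ N) ^ 2 = Real.exp (-(16 * γ ^ 2 * N)) := by
      rw [← Real.exp_nat_mul, ← Real.exp_nat_mul]
      congr 1
      push_cast
      ring
    rw [this] at e''
    nlinarith
  have hl := (Real.le_log_iff_exp_le (by positivity)).2 hexp
  rw [one_div, Real.log_inv]
  linarith

open Classical in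
theorem dim_le_of_learns (hk : 0 < k) (h0 : 0 ≤ γ) (h1 : γ ≤ 1 / 8) (hδ : δ ≤ 1 / 4)
    (hA : ∀ σ, 1 - δ ≤ ∑ y : Fin N → Fin k × Bool, (∏ i, coinWeight k γ σ (y i)) *
      if hammingErr (A y) σ ≤ k / 8 then 1 else 0) :
    (k : ℝ) ≤ 128 * γ ^ 2 * N := by
  have hk' : (0 : ℝ) < k := by positivity
  by_contra! hlt
  have hnn : ∀ σ (y : Fin N → Fin k × Bool), 0 ≤ ∏ i, coinWeight k γ σ (y i) := fun σ y =>
    Finset.prod_nonneg fun i _ => coinWeight_nonneg h0 (by linarith) _ _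
  let flip : Fin k → (Fin k → Bool) → Fin k → Bool := fun j σ => Function.update σ j (!σ j)
  have hflip : ∀ j, Function.Involutive (flip j) := fun j σ => by simp [flip]
  have hM : ∀ σ j, 3 / 4 < ∑ y : Fin N → Fin k × Bool,
      min (∏ i, coinWeight k γ σ (y i)) (∏ i, coinWeight k γ (flip j σ) (y i)) := fun σ j => by
    have haff := affinity_coinWeight hk h0 (by linarith) σ (flip j σ)
    have hham : (∑ i : Fin k, if σ i = flip j σ i then (0 : ℝ) else 1) = 1 := by
      rw [Finset.sum_eq_single j]
      · simp [flip]
      · intro i _ hi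
        simp [flip, hi]
      · simp
    rw [hham, mul_one] at haff
    have hpow := affinity_pow_le _ _ (coinWeight_nonneg h0 (by linarith) σ)
      (coinWeight_nonneg h0 (by linarith) (flip j σ)) (sum_coinWeight hk γ σ)
      (sum_coinWeight hk γ (flip j σ)) N
    set M := ∑ y : Fin N → Fin k × Bool,
      min (∏ i, coinWeight k γ σ (y i)) (∏ i, coinWeight k γ (flip j σ) (y i))
    have hx : 4 * γ ^ 2 / k ≤ 1 := by
      rw [div_le_one hk']
      have : (1 : ℝ) ≤ k := by exact_mod_cast hk
      nlinarith
    have hbern := one_add_mul_le_pow (a := -(4 * γ ^ 2 / k)) (by linarith) N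
    have hle := pow_le_pow_left₀ (by linarith) haff N
    have hNx : N * (4 * γ ^ 2 / k) < 1 / 32 := by
      rw [mul_div_assoc', div_lt_iff₀ hk']
      linarith
    rw [← sub_eq_add_neg] at hbern
    have hB : 31 / 32 < (∑ x, √(coinWeight k γ σ x * coinWeight k γ (flip j σ) x)) ^ N := by
      linarith
    nlinarith
  have hupper : ∀ σ, ∑ y : Fin N → Fin k × Bool,
      (∏ i, coinWeight k γ σ (y i)) * hammingErr (A y) σ ≤ 3 / 8 * k := fun σ => by
    have hb := mass_bad_le hk σ (hA σ)
    have hs : ∑ y : Fin N → Fin k × Bool, ∏ i, coinWeight k γ σ (y i) = 1 := by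
      rw [sum_prod_apply, sum_coinWeight hk, one_pow]
    calc _ ≤ ∑ y : Fin N → Fin k × Bool, ((∏ i, coinWeight k γ σ (y i)) * (k / 8) +
          ((∏ i, coinWeight k γ σ (y i)) *
            (if hammingErr (A y) σ ≤ k / 8 then (0 : ℝ) else 1)) * k) := by
          refine Finset.sum_le_sum fun y _ => ?_
          have hle : hammingErr (A y) σ ≤ k := by
            unfold hammingErr
            refine (Finset.sum_le_sum (g := fun _ => (1 : ℝ)) fun j _ => ?_).trans (by simp)
            split_ifs <;> norm_num
          rw [mul_assoc, ← mul_add]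
          refine mul_le_mul_of_nonneg_left ?_ (hnn σ y)
          split_ifs <;> linarith
      _ ≤ 3 / 8 * k := by
          rw [Finset.sum_add_distrib, ← Finset.sum_mul, ← Finset.sum_mul, hs]
          nlinarith
  have hlower : ∀ j, (3 / 8 : ℝ) * Fintype.card (Fin k → Bool) <
      ∑ σ, ∑ y : Fin N → Fin k × Bool,
        (∏ i, coinWeight k γ σ (y i)) * (if A y j = σ j then 0 else 1) := fun j => by
    set F : (Fin k → Bool) → ℝ := fun σ => ∑ y : Fin N → Fin k × Bool,
        (∏ i, coinWeight k γ σ (y i)) * (if A y j = σ j then 0 else 1) with hF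
    have hpair : ∀ σ, 3 / 4 < F σ + F (flip j σ) := fun σ => by
      refine (hM σ j).trans_le ?_
      rw [hF, ← Finset.sum_add_distrib]
      refine Finset.sum_le_sum fun y _ => ?_
      have m1 := min_le_left (∏ i, coinWeight k γ σ (y i)) (∏ i, coinWeight k γ (flip j σ) (y i))
      have m2 := min_le_right (∏ i, coinWeight k γ σ (y i)) (∏ i, coinWeight k γ (flip j σ) (y i))
      have hj : flip j σ j = !σ j := by simp [flip]
      rw [hj]
      have := hnn σ y
      have := hnn (flip j σ) y
      cases A y j <;> cases σ j <;> simp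
    have hsum : ∑ σ, F (flip j σ) = ∑ σ, F σ := Equiv.sum_comp (hflip j).toPerm F
    have := Finset.sum_lt_sum_of_nonempty (Finset.univ_nonempty (α := Fin k → Bool))
      fun σ _ => hpair σ
    rw [Finset.sum_add_distrib, hsum] at this
    simp only [Finset.sum_const, Finset.card_univ, nsmul_eq_mul] at this
    linarith
  have hl := Finset.sum_lt_sum_of_nonempty (s := (Finset.univ : Finset (Fin k)))
    ⟨⟨0, hk⟩, Finset.mem_univ _⟩ fun j _ => hlower j
  have hu := Finset.sum_le_sum fun σ (_ : σ ∈ Finset.univ) => hupper σ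
  rw [Finset.sum_comm] at hl
  have heq : ∀ σ : Fin k → Bool, ∑ j, ∑ y : Fin N → Fin k × Bool,
      (∏ i, coinWeight k γ σ (y i)) * (if A y j = σ j then (0 : ℝ) else 1) =
      ∑ y : Fin N → Fin k × Bool, (∏ i, coinWeight k γ σ (y i)) * hammingErr (A y) σ :=
    fun σ => by
      rw [Finset.sum_comm]
      simp only [hammingErr, Finset.mul_sum]
  simp only [heq, Finset.sum_const, Finset.card_univ, nsmul_eq_mul, Fintype.card_fin] at hl hu
  linarith

end LowerBounds

/-! ### The hard agent types -/

theorem bestResp_nonempty {n m : ℕ} (hn : 0 < n) (θ : AgentType n m) (t : Fin m → ℝ) :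
    (BestResp θ t).Nonempty := by
  have : Nonempty (Fin n) := ⟨⟨0, hn⟩⟩
  exact Finite.exists_max (uA θ t)

theorem uP_le {n m : ℕ} (hn : 0 < n) {r : Fin m → ℝ} {θ : AgentType n m} {t : Fin m → ℝ} {b : ℝ}
    (h : ∀ i ∈ BestResp θ t, uPa r θ t i ≤ b) : uP r θ t ≤ b :=
  csSup_le ((bestResp_nonempty hn θ t).image _) (Set.forall_mem_image.2 h)

theorem le_uP {n m : ℕ} (r : Fin m → ℝ) {θ : AgentType n m} {t : Fin m → ℝ} {i : Fin n}
    (h : i ∈ BestResp θ t) : uPa r θ t i ≤ uP r θ t :=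
  le_csSup ((Set.toFinite _).bddAbove) (Set.mem_image_of_mem _ h)

/-- Every action costs nothing and produces outcome `j`. -/
def freeType (n : ℕ) {k : ℕ} (j : Fin k) : AgentType n (k + 1) where
  f _ l := if l = j.succ then 1 else 0
  c _ := 0
  f_nonneg _ l := by split_ifs <;> norm_num
  f_sum _ := by simp
  c_nonneg _ := le_rfl
  c_zero _ _ := rfl

/-- Shirking produces outcome `0`; effort costs `q / 2` and produces outcome `j` with
probability `q`. -/
noncomputable def effortType (n : ℕ) {k : ℕ} (j : Fin k) (q : ℝ) (h0 : 0 ≤ q) (h1 : q ≤ 1) :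
    AgentType n (k + 1) where
  f i := if (i : ℕ) = 0 then Fin.cons 1 0 else Fin.cons (1 - q) (Pi.single j q)
  c i := if (i : ℕ) = 0 then 0 else q / 2
  f_nonneg i l := by
    have : (0 : Fin k → ℝ) ≤ Pi.single j q := Pi.single_nonneg.2 h0
    split_ifs
    · refine Fin.cases ?_ (fun l => ?_) l <;> simp
    · refine Fin.cases ?_ (fun l => ?_) l
      · simpa using h1
      · simpa using this l
  f_sum i := by split_ifs <;> simp [Fin.sum_univ_succ]
  c_nonneg i := by split_ifs <;> linarith
  c_zero i hi := if_pos hi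

section Utilities

variable {n k : ℕ} {r t : Fin (k + 1) → ℝ} {j : Fin k}

theorem uP_freeType (hn : 0 < n) (r t : Fin (k + 1) → ℝ) (j : Fin k) :
    uP r (freeType n j) t = r j.succ - t j.succ := by
  have h : ∀ i, uPa r (freeType n j) t i = r j.succ - t j.succ := fun i => by
    simp [uPa, freeType]
  refine le_antisymm (uP_le hn fun i _ => (h i).le) ?_
  obtain ⟨i, hi⟩ := bestResp_nonempty hn (freeType n j) t
  exact (h i).ge.trans (le_uP r hi)

variable {q : ℝ} {h0 : 0 ≤ q} {h1 : q ≤ 1}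

theorem uA_effortType (t : Fin (k + 1) → ℝ) (i : Fin n) :
    uA (effortType n j q h0 h1) t i =
      if (i : ℕ) = 0 then t 0 else (1 - q) * t 0 + q * t j.succ - q / 2 := by
  unfold uA effortType
  by_cases hi : (i : ℕ) = 0
  · simp [hi, Fin.sum_univ_succ]
  · simp [hi, Fin.sum_univ_succ, Pi.single_apply]

theorem uPa_effortType (hr : r 0 = 0) (t : Fin (k + 1) → ℝ) (i : Fin n) :
    uPa r (effortType n j q h0 h1) t i =
      if (i : ℕ) = 0 then -t 0 else (1 - q) * -t 0 + q * (r j.succ - t j.succ) := by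
  unfold uPa effortType
  by_cases hi : (i : ℕ) = 0
  · simp [hi, Fin.sum_univ_succ, hr]
  · simp [hi, Fin.sum_univ_succ, Pi.single_apply, hr]

theorem uP_effortType_le_zero (hn : 0 < n) (hq : 0 < q) (hr : r 0 = 0) (ht : 0 ≤ t 0)
    (hlt : t j.succ - t 0 < 1 / 2) : uP r (effortType n j q h0 h1) t ≤ 0 := by
  refine uP_le hn fun i hi => ?_
  rw [uPa_effortType hr]
  split_ifs with h
  · linarith
  · have := hi ⟨0, hn⟩
    rw [uA_effortType, uA_effortType, if_neg h, if_pos rfl] at this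
    nlinarith

theorem uP_effortType_le_half (hn : 0 < n) (hq : q * (r j.succ - 1 / 2) = 1 / 2) (hr : r 0 = 0)
    (ht : 0 ≤ t 0) (hge : 1 / 2 ≤ t j.succ - t 0) :
    uP r (effortType n j q h0 h1) t ≤ 1 / 2 := by
  refine uP_le hn fun i hi => ?_
  rw [uPa_effortType hr]
  split_ifs with h
  · linarith
  · nlinarith [mul_nonneg (sub_nonneg.2 h1) ht]

theorem half_le_uP_effortType (hn : 2 ≤ n) (hq : q * (r j.succ - 1 / 2) = 1 / 2) (hr : r 0 = 0)
    (ht : t 0 = 0) (htj : t j.succ = 1 / 2) : 1 / 2 ≤ uP r (effortType n j q h0 h1) t := by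
  have hb : (⟨1, hn⟩ : Fin n) ∈ BestResp (effortType n j q h0 h1) t := fun i => by
    rw [uA_effortType, uA_effortType, ht, htj]
    split_ifs <;> simp_all
    linarith
  refine le_trans ?_ (le_uP r hb)
  rw [uPa_effortType hr, ht, htj]
  simp
  linarith

theorem zero_le_uP_effortType (hn : 0 < n) (hr : r 0 = 0) (ht : t 0 = 0) (htj : t j.succ = 0) :
    0 ≤ uP r (effortType n j q h0 h1) t := by
  have hb : (⟨0, hn⟩ : Fin n) ∈ BestResp (effortType n j q h0 h1) t := fun i => by
    rw [uA_effortType, uA_effortType, ht, htj]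
    split_ifs <;> simp_all
    linarith
  refine le_trans ?_ (le_uP r hb)
  simp [uPa_effortType hr, ht]

end Utilities

/-! ### The embedding of the hypercube family -/

/-- The hard type indexed by a coordinate and a coin. -/
noncomputable def hardType (n : ℕ) {k : ℕ} (q : Fin k → ℝ) (h0 : ∀ j, 0 ≤ q j)
    (h1 : ∀ j, q j ≤ 1) (x : Fin k × Bool) : AgentType n (k + 1) :=
  if x.2 then effortType n x.1 (q x.1) (h0 x.1) (h1 x.1) else freeType n x.1

/-- Whether a contract incentivizes effort for outcome `j`. -/
noncomputable def guess {k : ℕ} (t : Fin (k + 1) → ℝ) (j : Fin k) : Bool :=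
  decide (1 / 2 ≤ t j.succ - t 0)

section Hard

variable {n k : ℕ} {r t : Fin (k + 1) → ℝ} {γ : ℝ} {q : Fin k → ℝ} {h0 : ∀ j, 0 ≤ q j}
  {h1 : ∀ j, q j ≤ 1}

/-- The optimal contribution of coordinate `j` to the principal's expected utility. -/
noncomputable def bestValue (γ : ℝ) (r : Fin (k + 1) → ℝ) (σ : Fin k → Bool) (j : Fin k) : ℝ :=
  1 / k * if σ j then γ + (1 / 2 - γ) * r j.succ else (1 / 2 + γ) * r j.succ

theorem value_le (hn : 0 < n) (hγ0 : 0 ≤ γ) (hγ1 : γ ≤ 1 / 2) (hr : r 0 = 0)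
    (hq : ∀ j, q j * (r j.succ - 1 / 2) = 1 / 2) (ht : t ∈ Cbounded (k + 1))
    (σ : Fin k → Bool) (j : Fin k) :
    ∑ b, coinWeight k γ σ (j, b) * uP r (hardType n q h0 h1 (j, b)) t ≤
      bestValue γ r σ j - γ / k * if guess t j = σ j then 0 else 1 := by
  have hqpos : 0 < q j := (h0 j).lt_of_ne fun h => by have := hq j; rw [← h] at this; norm_num at this
  have ht0 := (ht 0).1
  have htj := (ht j.succ).1
  have hfree := uP_freeType hn r t j
  have key : ∀ u v : ℝ, u ≤ v → 1 / (k : ℝ) * u ≤ 1 / k * v := fun u v h =>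
    mul_le_mul_of_nonneg_left h (by positivity)
  have hdiv : γ / k = 1 / k * γ := by ring
  rw [Fintype.sum_bool, hdiv, bestValue, mul_assoc, ← mul_sub]
  simp only [coinWeight, hardType, if_true, Bool.false_eq_true, if_false, hfree, mul_assoc]
  rw [← mul_add]
  apply key
  by_cases hg : 1 / 2 ≤ t j.succ - t 0
  · have hA := uP_effortType_le_half (h0 := h0 j) (h1 := h1 j) hn (hq j) hr ht0 hg
    set a := uP r (effortType n j (q j) (h0 j) (h1 j)) t
    have hg' : guess t j = true := by simpa [guess] using hg
    rw [hg']
    cases σ j <;> simp <;> nlinarith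
  · have hA := uP_effortType_le_zero (h0 := h0 j) (h1 := h1 j) hn hqpos hr ht0 (not_le.1 hg)
    set a := uP r (effortType n j (q j) (h0 j) (h1 j)) t
    have hg' : guess t j = false := by simpa [guess] using hg
    rw [hg']
    cases σ j <;> simp <;> nlinarith

/-- The contract paying `1/2` exactly on the outcomes selected by `σ`. -/
noncomputable def halfContract (σ : Fin k → Bool) : Fin (k + 1) → ℝ :=
  Fin.cons 0 fun j => if σ j then 1 / 2 else 0

theorem halfContract_mem (σ : Fin k → Bool) : halfContract σ ∈ Cbounded (k + 1) := by
  refine fun l => Fin.cases ?_ (fun j => ?_) l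
  · simp [halfContract]
  · simp only [halfContract, Fin.cons_succ]
    split_ifs <;> norm_num

theorem bestValue_le (hn : 2 ≤ n) (hγ0 : 0 ≤ γ) (hγ1 : γ ≤ 1 / 2) (hr : r 0 = 0)
    (hq : ∀ j, q j * (r j.succ - 1 / 2) = 1 / 2) (σ : Fin k → Bool) (j : Fin k) :
    bestValue γ r σ j ≤
      ∑ b, coinWeight k γ σ (j, b) * uP r (hardType n q h0 h1 (j, b)) (halfContract σ) := by
  have hfree := uP_freeType (by omega : 0 < n) r (halfContract σ) j
  have key : ∀ u v : ℝ, u ≤ v → 1 / (k : ℝ) * u ≤ 1 / k * v := fun u v h =>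
    mul_le_mul_of_nonneg_left h (by positivity)
  have ht0 : halfContract σ 0 = 0 := rfl
  rw [Fintype.sum_bool, bestValue]
  simp only [coinWeight, hardType, if_true, Bool.false_eq_true, if_false, hfree, mul_assoc]
  rw [← mul_add]
  apply key
  cases hσ : σ j
  · have htj : halfContract σ j.succ = 0 := by simp [halfContract, hσ]
    have hA := zero_le_uP_effortType (h0 := h0 j) (h1 := h1 j) (by omega : 0 < n) hr ht0 htj
    rw [htj]
    simp
    nlinarith
  · have htj : halfContract σ j.succ = 1 / 2 := by simp [halfContract, hσ]
    have hA := half_le_uP_effortType (h0 := h0 j) (h1 := h1 j) hn (hq j) hr ht0 htj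
    rw [htj]
    simp
    nlinarith

theorem regret_le (hn : 2 ≤ n) (hk : 0 < k) (hγ0 : 0 ≤ γ) (hγ1 : γ ≤ 1 / 2) (hr : r 0 = 0)
    (hq : ∀ j, q j * (r j.succ - 1 / 2) = 1 / 2) (ht : t ∈ Cbounded (k + 1))
    (σ : Fin k → Bool) :
    expect (FinDist.pushforward (coinWeight k γ σ) (coinWeight_nonneg hγ0 hγ1 σ)
        (sum_coinWeight hk γ σ) (hardType n q h0 h1)) (fun θ => uP r θ t) ≤
      OPT (Cbounded (k + 1)) r (FinDist.pushforward (coinWeight k γ σ)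
        (coinWeight_nonneg hγ0 hγ1 σ) (sum_coinWeight hk γ σ) (hardType n q h0 h1)) -
      γ / k * hammingErr (guess t) σ := by
  have hup : ∀ t ∈ Cbounded (k + 1), expect (FinDist.pushforward (coinWeight k γ σ)
      (coinWeight_nonneg hγ0 hγ1 σ) (sum_coinWeight hk γ σ) (hardType n q h0 h1))
      (fun θ => uP r θ t) ≤ ∑ j, bestValue γ r σ j - γ / k * hammingErr (guess t) σ :=
    fun t ht => by
      rw [expect_pushforward, Fintype.sum_prod_type, hammingErr, Finset.mul_sum,
        ← Finset.sum_sub_distrib]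
      exact Finset.sum_le_sum fun j _ => value_le (by omega) hγ0 hγ1 hr hq ht σ j
  have herr : ∀ t : Fin (k + 1) → ℝ, 0 ≤ γ / k * hammingErr (guess t) σ := fun t =>
    mul_nonneg (by positivity) (Finset.sum_nonneg fun j _ => by split_ifs <;> norm_num)
  have hopt : ∑ j, bestValue γ r σ j ≤ OPT (Cbounded (k + 1)) r
      (FinDist.pushforward (coinWeight k γ σ) (coinWeight_nonneg hγ0 hγ1 σ)
        (sum_coinWeight hk γ σ) (hardType n q h0 h1)) := by
    refine le_trans ?_ (le_csSup ⟨∑ j, bestValue γ r σ j, ?_⟩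
      (Set.mem_image_of_mem _ (halfContract_mem σ)))
    · simp only [expect_pushforward, Fintype.sum_prod_type]
      exact Finset.sum_le_sum fun j _ => bestValue_le hn hγ0 hγ1 hr hq σ j
    · rintro _ ⟨t, ht, rfl⟩
      have := hup t ht
      have := herr t
      linarith
  have := hup t ht
  linarith

end Hard

/-- Sample complexity lower bound for bounded contracts. With `n, m ≥ 2`,
`r 0 = 0` and `r j ≥ 1` for `j ≠ 0`, there is an absolute constant `c > 0` such that
any learning rule returning bounded contracts which is `(ε, δ)`-PAC for every finitely
supported type distribution must use `N ≥ c·(1/ε²)·(m + log(1/δ))` samples. -/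
theorem stmt_16 : ∃ c : ℝ, 0 < c ∧
    ∀ (n m : ℕ), 2 ≤ n → 2 ≤ m → ∀ r : Fin m → ℝ,
      (∀ j, 0 ≤ r j) → (∀ j : Fin m, (j : ℕ) = 0 → r j = 0) →
      (∀ j : Fin m, (j : ℕ) ≠ 0 → 1 ≤ r j) →
      ∀ ε δ : ℝ, 0 < ε → ε < 1/64 → 0 < δ → δ ≤ 1/4 →
      ∀ N : ℕ, ∀ 𝒜 : (Fin N → AgentType n m) → (Fin m → ℝ),
        (∀ s, 𝒜 s ∈ Cbounded m) →
        (∀ D : FinDist (AgentType n m),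
          prodProb D N
            {s | expect D (fun θ => uP r θ (𝒜 s)) ≥ OPT (Cbounded m) r D - ε} ≥ 1 - δ) →
        (N : ℝ) ≥ c * (1/ε^2) * ((m : ℝ) + Real.log (1/δ)) := by
  classical
  refine ⟨1 / 65536, by norm_num, ?_⟩
  intro n m hn hm r hr0 hrz hr1 ε δ hε hε1 hδ hδ1 N 𝒜 h𝒜 hpac
  obtain ⟨k, rfl⟩ : ∃ k, m = k + 1 := ⟨m - 1, by omega⟩
  have hk : 0 < k := by omega
  have hk' : (1 : ℝ) ≤ k := by exact_mod_cast hk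
  have hrj : ∀ j : Fin k, 1 ≤ r j.succ := fun j => hr1 _ (by simp)
  have hr : r 0 = 0 := hrz 0 rfl
  set q : Fin k → ℝ := fun j => 1 / (2 * r j.succ - 1) with hq_def
  have h0 : ∀ j, 0 ≤ q j := fun j => one_div_nonneg.2 (by linarith [hrj j])
  have h1 : ∀ j, q j ≤ 1 := fun j => (div_le_one (by linarith [hrj j])).2 (by linarith [hrj j])
  have hq : ∀ j, q j * (r j.succ - 1 / 2) = 1 / 2 := fun j => by
    have : 2 * r j.succ - 1 ≠ 0 := by linarith [hrj j]
    simp only [hq_def]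
    field_simp
  have hγ0 : 0 ≤ 8 * ε := by linarith
  have hγ1 : 8 * ε ≤ 1 / 2 := by linarith
  have hA : ∀ σ, 1 - δ ≤ ∑ y : Fin N → Fin k × Bool, (∏ i, coinWeight k (8 * ε) σ (y i)) *
      if hammingErr (guess (𝒜 (hardType n q h0 h1 ∘ y))) σ ≤ k / 8 then 1 else 0 := fun σ => by
    have h := hpac (FinDist.pushforward (coinWeight k (8 * ε) σ) (coinWeight_nonneg hγ0 hγ1 σ)
      (sum_coinWeight hk _ σ) (hardType n q h0 h1))
    rw [prodProb_pushforward] at h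
    refine h.le.trans (Finset.sum_le_sum fun y _ => mul_le_mul_of_nonneg_left ?_
      (Finset.prod_nonneg fun i _ => coinWeight_nonneg hγ0 hγ1 _ _))
    split_ifs with hs hb
    · exact le_rfl
    · have hs' := hs.out
      have hreg := regret_le (h0 := h0) (h1 := h1) hn hk hγ0 hγ1 hr hq
        (h𝒜 (hardType n q h0 h1 ∘ y)) σ
      refine absurd ?_ hb
      have hle : 8 * ε / k * hammingErr (guess (𝒜 (hardType n q h0 h1 ∘ y))) σ ≤ ε := by linarith
      rw [div_mul_eq_mul_div, div_le_iff₀ (by linarith)] at hle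
      nlinarith
    · exact zero_le_one
    · exact le_rfl
  have hdim := dim_le_of_learns hk hγ0 (by linarith) hδ1 hA
  have hlog := log_le_of_learns hk hγ0 (by linarith) hδ hA
  have hsplit : Real.log (1 / δ) = Real.log 4 + Real.log (1 / (4 * δ)) := by
    rw [← Real.log_mul (by norm_num) (by positivity)]
    congr 1
    field_simp
  have hlog4 : Real.log 4 ≤ 2 := by
    have : (4 : ℝ) = 2 ^ 2 := by norm_num
    rw [this, Real.log_pow]
    have := Real.log_two_lt_d9
    push_cast
    linarith
  rw [hsplit, ge_iff_le, mul_assoc, one_div_mul_eq_div, one_div_mul_eq_div, div_div,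
    div_le_iff₀ (by positivity)]
  push_cast
  nlinarith [mul_nonneg (sq_nonneg ε) (Nat.cast_nonneg (α := ℝ) N)]
end

section
/- There is an absolute constant A > 0 such that for all K ≥ 1, n ≥ 2, m ≥ 2 and all rewards r, the pseudo-dimension of the class M_unbounded^K of all menus of K unbounded contracts is at most A·K·m·log₂(K·m·n); consequently the same bound holds for the class M_bounded^K of menus of K bounded contracts. -/
open scoped BigOperators

/-- The agent's utility from choosing contract `p.1` of the menu `M` and action `p.2`. -/
def uAmenu {n m K : ℕ} (θ : AgentType n m) (M : Fin K → Fin m → ℝ)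
    (p : Fin K × Fin n) : ℝ :=
  uA θ (M p.1) p.2

/-- The agent's best responses (contract choice, action) to a menu `M`. -/
def BestRespMenu {n m K : ℕ} (θ : AgentType n m) (M : Fin K → Fin m → ℝ) :
    Set (Fin K × Fin n) :=
  {p | ∀ q, uAmenu θ M q ≤ uAmenu θ M p}

/-- The principal's utility from a menu, with ties broken in favor of the principal. -/
noncomputable def uPMenu {n m K : ℕ} (r : Fin m → ℝ) (θ : AgentType n m)
    (M : Fin K → Fin m → ℝ) : ℝ :=
  sSup ((fun p => uPa r θ (M p.1) p.2) '' BestRespMenu θ M)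

/-- The class of menus of `K` unbounded contracts. -/
def MenuUnbounded (K m : ℕ) : Set (Fin K → Fin m → ℝ) := {M | ∀ k j, 0 ≤ M k j}

/-- The class of menus of `K` bounded contracts. -/
def MenuBounded (K m : ℕ) : Set (Fin K → Fin m → ℝ) :=
  {M | ∀ k j, M k j ∈ Set.Icc (0:ℝ) 1}

/-- Pseudo-dimension shattering for a class of menus on the full type space. -/
def ShattersMenu (n : ℕ) {m K : ℕ} (r : Fin m → ℝ) (C : Set (Fin K → Fin m → ℝ))
    (d : ℕ) : Prop :=
  ∃ θ : Fin d → AgentType n m, ∃ τ : Fin d → ℝ,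
    ∀ S : Finset (Fin d), ∃ M ∈ C,
      (∀ j, j ∈ S → τ j ≤ uPMenu r (θ j) M) ∧ (∀ j, j ∉ S → uPMenu r (θ j) M < τ j)

/-- The sign vector of a point under a finite family of linear functionals. -/
noncomputable def signVector {ι V : Type*} [AddCommGroup V] [Module ℝ V]
    (L : ι → V →ₗ[ℝ] ℝ) (x : V) : ι → SignType :=
  fun i => SignType.sign (L i x)

lemma sign_nonneg_combination {a b u v : ℝ} (ha : 0 ≤ a) (hb : 0 ≤ b) (hab : 0 < a + b)
    (huv : SignType.sign u = SignType.sign v) :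
    SignType.sign (a * u + b * v) = SignType.sign u := by
  rcases lt_trichotomy u 0 with hu | hu | hu
  · rw [sign_neg hu] at huv ⊢
    have hv : v < 0 := sign_eq_neg_one_iff.1 huv.symm
    refine sign_neg ?_
    rcases ha.eq_or_lt with rfl | ha
    · nlinarith
    · nlinarith
  · subst hu
    rw [sign_zero] at huv
    have hv : v = 0 := sign_eq_zero_iff.1 huv.symm
    simp [hv]
  · rw [sign_pos hu] at huv ⊢
    have hv : 0 < v := sign_eq_one_iff.1 huv.symm
    refine sign_pos ?_
    rcases ha.eq_or_lt with rfl | ha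
    · nlinarith
    · nlinarith

lemma abs_mul_add_abs_mul_eq_zero {u v : ℝ} (huv : SignType.sign u ≠ SignType.sign v) :
    |v| * u + |u| * v = 0 := by
  rcases lt_trichotomy u 0 with hu | hu | hu <;> rcases lt_trichotomy v 0 with hv | hv | hv
  all_goals first
    | (refine absurd ?_ huv; simp [hu, hv, sign_neg, sign_pos]; done)
    | (simp [hu, hv])
    | (simp only [abs_of_neg, abs_of_pos, hu, hv]; ring)

/-- Two points of a subspace with the same sign vector on different sides of a hyperplane
can be joined across the hyperplane without changing the sign vector. -/
lemma exists_mem_ker_signVector_eq {ι V : Type*} [AddCommGroup V] [Module ℝ V]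
    (L : ι → V →ₗ[ℝ] ℝ) (h : V →ₗ[ℝ] ℝ) (W : Submodule ℝ V) {x y : V}
    (hx : x ∈ W) (hy : y ∈ W) (hxy : signVector L x = signVector L y)
    (hne : SignType.sign (h x) ≠ SignType.sign (h y)) :
    ∃ z ∈ W ⊓ LinearMap.ker h, signVector L z = signVector L x := by
  refine ⟨|h y| • x + |h x| • y,
    ⟨W.add_mem (W.smul_mem _ hx) (W.smul_mem _ hy), ?_⟩, ?_⟩
  · simpa using abs_mul_add_abs_mul_eq_zero hne
  · have hpos : 0 < |h y| + |h x| := by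
      by_contra hcon
      have h1 := abs_nonneg (h y)
      have h2 := abs_nonneg (h x)
      have h3 : h y = 0 := abs_eq_zero.1 (by linarith)
      have h4 : h x = 0 := abs_eq_zero.1 (by linarith)
      exact hne (by rw [h3, h4])
    funext i
    simpa [signVector] using
      sign_nonneg_combination (abs_nonneg (h y)) (abs_nonneg (h x)) hpos (congrFun hxy i)

/-- A central arrangement of `N` hyperplanes in a space of dimension `D` has at most
`(3 * N + 1) ^ D` sign vectors. -/
lemma ncard_signVector_image_le {V : Type*} [AddCommGroup V] [Module ℝ V]
    [FiniteDimensional ℝ V] (N : ℕ) (L : Fin N → V →ₗ[ℝ] ℝ) (W : Submodule ℝ V) :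
    (signVector L '' (W : Set V)).ncard ≤ (3 * N + 1) ^ Module.finrank ℝ W := by
  induction N generalizing W with
  | zero =>
    have h : (signVector L '' (W : Set V)).ncard ≤ 1 :=
      Set.ncard_le_one_of_subsingleton _
    simpa using h
  | succ N ih =>
    set T : Fin N → V →ₗ[ℝ] ℝ := fun i => L i.succ with hT
    set h := L 0 with hh
    have hcons : ∀ x, signVector L x = Fin.cons (SignType.sign (h x)) (signVector T x) := by
      intro x
      funext i
      refine Fin.cases ?_ (fun i => ?_) i <;> simp [signVector, hT, hh]
    have hexists : ∀ p : Fin N → SignType, ∃ s : SignType,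
        ∀ x ∈ W, signVector T x = p → SignType.sign (h x) ≠ s →
          p ∈ signVector T '' ((W ⊓ LinearMap.ker h : Submodule ℝ V) : Set V) := by
      intro p
      by_cases hp : ∃ y ∈ W, signVector T y = p
      · obtain ⟨y, hy, rfl⟩ := hp
        refine ⟨SignType.sign (h y), fun x hx hxy hne => ?_⟩
        obtain ⟨z, hz, hzx⟩ := exists_mem_ker_signVector_eq T h W hx hy hxy hne
        exact ⟨z, hz, hzx.trans hxy⟩
      · exact ⟨0, fun x hx hxp => absurd ⟨x, hx, hxp⟩ hp⟩
    choose s hs using hexists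
    by_cases hW : W ≤ LinearMap.ker h
    · have hsub : signVector L '' (W : Set V) ⊆
          (fun p : Fin N → SignType => (Fin.cons 0 p : Fin (N + 1) → SignType)) ''
            (signVector T '' (W : Set V)) := by
        rintro _ ⟨x, hx, rfl⟩
        have h0 : h x = 0 := hW hx
        exact ⟨_, ⟨x, hx, rfl⟩, by rw [hcons, h0, sign_zero]⟩
      calc _ ≤ _ := Set.ncard_le_ncard hsub (Set.toFinite _)
        _ ≤ _ := Set.ncard_image_le (Set.toFinite _)
        _ ≤ _ := ih T W
        _ ≤ _ := Nat.pow_le_pow_left (by omega) _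
    · set U := W ⊓ LinearMap.ker h with hU
      have hlt : Module.finrank ℝ U < Module.finrank ℝ W :=
        Submodule.finrank_lt_finrank_of_lt (inf_lt_left.2 hW)
      have hsub : signVector L '' (W : Set V) ⊆
          (fun p : Fin N → SignType => (Fin.cons (s p) p : Fin (N + 1) → SignType)) ''
            (signVector T '' (W : Set V)) ∪
          (fun q : SignType × (Fin N → SignType) =>
            (Fin.cons q.1 q.2 : Fin (N + 1) → SignType)) ''
            (Set.univ ×ˢ (signVector T '' (U : Set V))) := by
        rintro _ ⟨x, hx, rfl⟩
        by_cases hsx : SignType.sign (h x) = s (signVector T x)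
        · exact Or.inl ⟨_, ⟨x, hx, rfl⟩, by rw [hcons, hsx]⟩
        · exact Or.inr ⟨(SignType.sign (h x), signVector T x),
            ⟨trivial, hs _ x hx rfl hsx⟩, (hcons x).symm⟩
      have hprod : (Set.univ ×ˢ (signVector T '' (U : Set V)) :
          Set (SignType × (Fin N → SignType))).ncard =
          3 * (signVector T '' (U : Set V)).ncard := by
        rw [Set.ncard_prod, Set.ncard_univ, Nat.card_eq_fintype_card]
        rfl
      obtain ⟨D, hD⟩ : ∃ D, Module.finrank ℝ W = D + 1 := ⟨Module.finrank ℝ W - 1, by omega⟩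
      have h1 : (signVector T '' (W : Set V)).ncard ≤ (3 * N + 1) ^ (D + 1) := hD ▸ ih T W
      have h2 : (signVector T '' (U : Set V)).ncard ≤ (3 * N + 1) ^ D :=
        (ih T U).trans (Nat.pow_le_pow_right (by omega) (by omega))
      have h3 : (3 * N + 1) ^ D ≤ (3 * (N + 1) + 1) ^ D := Nat.pow_le_pow_left (by omega) _
      calc _ ≤ _ := Set.ncard_le_ncard hsub (Set.toFinite _)
        _ ≤ _ := Set.ncard_union_le _ _
        _ ≤ (signVector T '' (W : Set V)).ncard + 3 * (signVector T '' (U : Set V)).ncard :=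
          add_le_add (Set.ncard_image_le (Set.toFinite _))
            (hprod ▸ Set.ncard_image_le (Set.toFinite _))
        _ ≤ (3 * N + 1) ^ (D + 1) + 3 * (3 * N + 1) ^ D := by omega
        _ = (3 * (N + 1) + 1) * (3 * N + 1) ^ D := by ring
        _ ≤ (3 * (N + 1) + 1) * (3 * (N + 1) + 1) ^ D := Nat.mul_le_mul_left _ h3
        _ = (3 * (N + 1) + 1) ^ Module.finrank ℝ W := by rw [hD]; ring

/-- Points with pairwise distinct sign vectors are few. -/
lemma card_le_of_injective_signVector {ι V α : Type*} [Fintype ι] [Fintype α]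
    [AddCommGroup V] [Module ℝ V] [FiniteDimensional ℝ V] (L : ι → V →ₗ[ℝ] ℝ) (g : α → V)
    (hg : Function.Injective fun a => signVector L (g a)) :
    Fintype.card α ≤ (3 * Fintype.card ι + 1) ^ Module.finrank ℝ V := by
  set e := (Fintype.equivFin ι).symm
  have hinj : Function.Injective fun a => signVector (L ∘ e) (g a) := by
    intro a b hab
    refine hg (funext fun i => ?_)
    simpa [signVector] using congrFun hab (e.symm i)
  have hsub : Set.range (fun a => signVector (L ∘ e) (g a)) ⊆
      signVector (L ∘ e) '' ((⊤ : Submodule ℝ V) : Set V) := by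
    rintro _ ⟨a, rfl⟩
    exact ⟨g a, trivial, rfl⟩
  have h := (Set.ncard_le_ncard hsub (Set.toFinite _)).trans
    (ncard_signVector_image_le _ (L ∘ e) ⊤)
  rwa [← Set.image_univ, Set.ncard_image_of_injective _ hinj, Set.ncard_univ,
    Nat.card_eq_fintype_card, finrank_top] at h

/-- The payment for outcome `j` in the menu entry `k`, as a linear functional. -/
def paymentFunctional {m K : ℕ} (k : Fin K) (j : Fin m) :
    (Fin K → Fin m → ℝ) × ℝ →ₗ[ℝ] ℝ where
  toFun x := x.1 k j
  map_add' _ _ := rfl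
  map_smul' _ _ := rfl

/-- The homogenization of the agent's utility `uAmenu` in the menu. -/
def agentFunctional {n m K : ℕ} (θ : AgentType n m) (p : Fin K × Fin n) :
    (Fin K → Fin m → ℝ) × ℝ →ₗ[ℝ] ℝ :=
  ∑ j, θ.f p.2 j • paymentFunctional p.1 j - θ.c p.2 • LinearMap.snd ℝ _ _

/-- The homogenization of the principal's utility minus `τ` in the menu. -/
def principalFunctional {n m K : ℕ} (r : Fin m → ℝ) (θ : AgentType n m) (τ : ℝ)
    (p : Fin K × Fin n) : (Fin K → Fin m → ℝ) × ℝ →ₗ[ℝ] ℝ :=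
  ∑ j, θ.f p.2 j • (r j • LinearMap.snd ℝ _ _ - paymentFunctional p.1 j) -
    τ • LinearMap.snd ℝ _ _

lemma agentFunctional_apply {n m K : ℕ} (θ : AgentType n m) (p : Fin K × Fin n)
    (M : Fin K → Fin m → ℝ) : agentFunctional θ p (M, 1) = uAmenu θ M p := by
  simp [agentFunctional, paymentFunctional, uAmenu, uA, LinearMap.sum_apply]

lemma principalFunctional_apply {n m K : ℕ} (r : Fin m → ℝ) (θ : AgentType n m) (τ : ℝ)
    (p : Fin K × Fin n) (M : Fin K → Fin m → ℝ) :
    principalFunctional r θ τ p (M, 1) = uPa r θ (M p.1) p.2 - τ := by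
  simp [principalFunctional, paymentFunctional, uPa, LinearMap.sum_apply]

/-- The linear functionals whose signs decide whether the principal's utility from a menu
reaches the threshold `τ j` for the type `θ j`. -/
def menuFunctional {n m K d : ℕ} (r : Fin m → ℝ) (θ : Fin d → AgentType n m) (τ : Fin d → ℝ) :
    Fin d × ((Fin K × Fin n) × Option (Fin K × Fin n)) → (Fin K → Fin m → ℝ) × ℝ →ₗ[ℝ] ℝ
  | (j, p, none) => principalFunctional r (θ j) (τ j) p
  | (j, p, some q) => agentFunctional (θ j) p - agentFunctional (θ j) q

lemma le_uPMenu_iff {n m K : ℕ} (hK : 1 ≤ K) (hn : 1 ≤ n) (r : Fin m → ℝ)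
    (θ : AgentType n m) (M : Fin K → Fin m → ℝ) (τ : ℝ) :
    τ ≤ uPMenu r θ M ↔ ∃ p ∈ BestRespMenu θ M, τ ≤ uPa r θ (M p.1) p.2 := by
  have : Nonempty (Fin K × Fin n) := ⟨(⟨0, hK⟩, ⟨0, hn⟩)⟩
  have hne : (BestRespMenu θ M).Nonempty := Finite.exists_max (uAmenu θ M)
  have hfin : ((fun p : Fin K × Fin n => uPa r θ (M p.1) p.2) '' BestRespMenu θ M).Finite :=
    Set.toFinite _
  constructor
  · intro h
    obtain ⟨p, hp, hpe⟩ := (hne.image fun p => uPa r θ (M p.1) p.2).csSup_mem hfin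
    exact ⟨p, hp, h.trans_eq hpe.symm⟩
  · rintro ⟨p, hp, h⟩
    exact h.trans (le_csSup hfin.bddAbove ⟨p, hp, rfl⟩)

lemma le_uPMenu_iff_signVector {n m K d : ℕ} (hK : 1 ≤ K) (hn : 1 ≤ n) (r : Fin m → ℝ)
    (θ : Fin d → AgentType n m) (τ : Fin d → ℝ) (M : Fin K → Fin m → ℝ) (j : Fin d) :
    τ j ≤ uPMenu r (θ j) M ↔
      ∃ p, (∀ q, 0 ≤ signVector (menuFunctional r θ τ) (M, 1) (j, p, some q)) ∧
        0 ≤ signVector (menuFunctional r θ τ) (M, 1) (j, p, none) := by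
  simp [le_uPMenu_iff hK hn, BestRespMenu, signVector, menuFunctional, sign_nonneg_iff,
    agentFunctional_apply, principalFunctional_apply]

lemma two_pow_le_of_shattersMenu {n m K d : ℕ} (hK : 1 ≤ K) (hn : 1 ≤ n) {r : Fin m → ℝ}
    {C : Set (Fin K → Fin m → ℝ)} (h : ShattersMenu n r C d) :
    2 ^ d ≤ (3 * (d * (K * n * (K * n + 1))) + 1) ^ (K * m + 1) := by
  obtain ⟨θ, τ, h⟩ := h
  choose M _ hM using h
  have key : ∀ S j, j ∈ S ↔ τ j ≤ uPMenu r (θ j) (M S) := fun S j =>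
    ⟨(hM S).1 j, fun hj => by_contra fun hS => ((hM S).2 j hS).not_ge hj⟩
  have hinj : Function.Injective fun S => signVector (menuFunctional r θ τ) (M S, 1) := by
    intro S S' hS
    ext j
    rw [key, key, le_uPMenu_iff_signVector hK hn, le_uPMenu_iff_signVector hK hn]
    rw [show signVector (menuFunctional r θ τ) (M S, 1) =
      signVector (menuFunctional r θ τ) (M S', 1) from hS]
  have hcard := card_le_of_injective_signVector (menuFunctional r θ τ) (fun S => (M S, 1)) hinj
  simpa [Module.finrank_prod, Module.finrank_pi_fintype] using hcard

lemma logb_two_le_two_mul {y : ℝ} (hy : 0 < y) : Real.logb 2 y ≤ 2 * y := by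
  have h2 := Real.log_two_gt_d9
  have h := Real.log_le_sub_one_of_pos hy
  rw [Real.logb, div_le_iff₀ (by linarith)]
  nlinarith

lemma le_of_two_pow_le {K n m d : ℕ} (hK : 1 ≤ K) (hn : 2 ≤ n) (hm : 2 ≤ m)
    (h : 2 ^ d ≤ (3 * (d * (K * n * (K * n + 1))) + 1) ^ (K * m + 1)) :
    (d : ℝ) ≤ 20 * K * m * Real.logb 2 ((K : ℝ) * m * n) := by
  have hK' : (1 : ℝ) ≤ K := by exact_mod_cast hK
  have hn' : (2 : ℝ) ≤ n := by exact_mod_cast hn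
  have hm' : (2 : ℝ) ≤ m := by exact_mod_cast hm
  set D : ℝ := K * m with hD
  set X : ℝ := D * n with hX
  have hD2 : 2 ≤ D := by nlinarith
  have hX4 : 4 ≤ X := by nlinarith
  set Λ := Real.logb 2 X with hΛ
  have hΛ0 : 0 ≤ Λ := Real.logb_nonneg (by norm_num) (by linarith)
  rw [mul_assoc 20 (K : ℝ) m, ← hD]
  rcases Nat.eq_zero_or_pos d with rfl | hd
  · simp only [Nat.cast_zero]; positivity
  have hd' : (1 : ℝ) ≤ d := by exact_mod_cast hd
  have hd0 : (0 : ℝ) < d := by linarith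
  have hpow : (2 : ℝ) ^ d ≤ (3 * (d * (K * n * (K * n + 1))) + 1) ^ (K * m + 1) := by
    exact_mod_cast h
  have hbase : (3 * (d * ((K : ℝ) * n * (K * n + 1))) + 1) ≤ d * X ^ 3 := by
    set y : ℝ := K * n with hy
    have hy2 : 2 ≤ y := by nlinarith
    have hyX : 2 * y ≤ X := by
      have : X = y * m := by rw [hX, hD, hy]; ring
      nlinarith
    have h1 : 3 * (y * (y + 1)) + 1 ≤ 5 * y ^ 2 := by nlinarith
    have h2 : 4 * y ^ 2 ≤ X ^ 2 := by nlinarith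
    have h3 : X ^ 2 * 4 ≤ X ^ 3 := by nlinarith [sq_nonneg X]
    have h4 : 3 * (y * (y + 1)) + 1 ≤ X ^ 3 := by nlinarith
    calc 3 * (d * (y * (y + 1))) + 1 ≤ d * (3 * (y * (y + 1)) + 1) := by linarith
      _ ≤ d * X ^ 3 := by gcongr
  have hlog : (d : ℝ) ≤ (D + 1) * (Real.logb 2 d + 3 * Λ) := by
    have h1 := Real.logb_le_logb_of_le (b := 2) (by norm_num) (by positivity)
      (hpow.trans (pow_le_pow_left₀ (by positivity) hbase _))
    rw [Real.logb_pow, Real.logb_pow, Real.logb_mul (by positivity) (by positivity),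
      Real.logb_pow, Real.logb_self_eq_one (by norm_num)] at h1
    push_cast at h1
    rw [← hD] at h1
    linarith
  have hlogd : Real.logb 2 d ≤ d / (4 * D) + 2 * Λ := by
    have h1 : Real.logb 2 d = Real.logb 2 (d / (8 * D)) + Real.logb 2 (8 * D) := by
      rw [← Real.logb_mul (by positivity) (by positivity)]
      congr 1
      field_simp
    have h2 : Real.logb 2 (d / (8 * D)) ≤ 2 * (d / (8 * D)) :=
      logb_two_le_two_mul (by positivity)
    have h3 : 2 * ((d : ℝ) / (8 * D)) = d / (4 * D) := by field_simp; norm_num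
    have h4 : Real.logb 2 (8 * D) ≤ 2 * Λ := by
      have h5 : 8 * D ≤ X ^ 2 := by
        have : 2 * D ≤ X := by nlinarith
        nlinarith
      have h6 := Real.logb_le_logb_of_le (b := 2) (by norm_num) (by positivity) h5
      rwa [Real.logb_pow] at h6
    linarith
  have hsum : Real.logb 2 d + 3 * Λ ≤ d / (4 * D) + 5 * Λ := by linarith
  have hcancel : 2 * D * (d / (4 * D) + 5 * Λ) = d / 2 + 10 * (D * Λ) := by
    field_simp
    ring
  have hfinal : (d : ℝ) ≤ 2 * D * (d / (4 * D) + 5 * Λ) := by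
    have h0 : 0 ≤ (d : ℝ) / (4 * D) + 5 * Λ := by positivity
    calc (d : ℝ) ≤ (D + 1) * (Real.logb 2 d + 3 * Λ) := hlog
      _ ≤ (D + 1) * (d / (4 * D) + 5 * Λ) := by gcongr
      _ ≤ 2 * D * (d / (4 * D) + 5 * Λ) := by gcongr; linarith
  rw [hcancel] at hfinal
  linarith

/-- There is an absolute constant `A > 0` such that for all `K ≥ 1` and
`n, m ≥ 2`, the pseudo-dimension of the class of menus of `K` unbounded contracts is at
most `A·K·m·log₂(K·m·n)`; the same bound holds for menus of `K` bounded contracts. -/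
theorem stmt_19 : ∃ A : ℝ, 0 < A ∧
    ∀ (K n m : ℕ), 1 ≤ K → 2 ≤ n → 2 ≤ m → ∀ r : Fin m → ℝ,
      (∀ j, 0 ≤ r j) → (∀ j : Fin m, (j : ℕ) = 0 → r j = 0) →
      (∀ d : ℕ, ShattersMenu n r (MenuUnbounded K m) d →
          (d : ℝ) ≤ A * K * m * Real.logb 2 ((K : ℝ) * m * n)) ∧
      (∀ d : ℕ, ShattersMenu n r (MenuBounded K m) d →
          (d : ℝ) ≤ A * K * m * Real.logb 2 ((K : ℝ) * m * n)) := by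
  refine ⟨20, by norm_num, fun K n m hK hn hm r _ _ => ⟨fun d h => ?_, fun d h => ?_⟩⟩ <;>
    exact le_of_two_pow_le hK hn hm (two_pow_le_of_shattersMenu hK (by omega) h)
end
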